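/- Let E_N and H_N denote the top-left and bottom-right 2^{N-1}×2^{N-1} blocks of Q_N^{(g)}. Then tr(E_N) = a00^00 tr(E_{N-1}) + a01^01 tr(H_{N-1}) and tr(H_N) = a10^10 tr(E_{N-1}) + a11^11 tr(H_{N-1}) for N ≥ 2. -/

import Mathlib

open Matrix Kronecker

/-- Configuration space of `N` sites, each holding a state in `{0,1}`. -/
abbrev Conf (N : ℕ) := Fin N → Fin 2

/-- `Fin 2 × Conf N ≃ Conf (N+1)` by prepending the first bit. -/
def confEquiv (N : ℕ) : Fin 2 × Conf N ≃ Conf (N + 1) :=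
  Fin.consEquiv (fun _ => Fin 2)

/-- `(Fin 2 × Fin 2) × Conf N ≃ Conf (N+2)` by prepending the first two bits. -/
def confEquiv2 (N : ℕ) : (Fin 2 × Fin 2) × Conf N ≃ Conf (N + 2) :=
  (((Equiv.prodAssoc (Fin 2) (Fin 2) (Conf N)).trans
    ((Equiv.refl (Fin 2)).prodCongr (confEquiv N))).trans (confEquiv (N + 1)))

/-- The global operator `Q_N^{(g)}`, defined by `Q_1 = I_2` and
`Q_{N+1} = (I_2 ⊗ Q_N) (Q^{(l)} ⊗ I_{2^{N-1}})`. -/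
def Qg {R : Type*} [CommRing R] (Ql : Matrix (Fin 2 × Fin 2) (Fin 2 × Fin 2) R) :
    (N : ℕ) → Matrix (Conf N) (Conf N) R
  | 0 => 1
  | 1 => 1
  | (N + 2) =>
      (Matrix.reindex (confEquiv (N + 1)) (confEquiv (N + 1))
          ((1 : Matrix (Fin 2) (Fin 2) R) ⊗ₖ Qg Ql (N + 1))) *
      (Matrix.reindex (confEquiv2 N) (confEquiv2 N)
          (Ql ⊗ₖ (1 : Matrix (Conf N) (Conf N) R)))

/-- Top-left block `E`. -/
def blockTL {R : Type*} [CommRing R] {N : ℕ}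
    (M : Matrix (Conf (N + 1)) (Conf (N + 1)) R) : Matrix (Conf N) (Conf N) R :=
  Matrix.of fun x y => M (Fin.cons 0 x) (Fin.cons 0 y)

/-- Top-right block `F`. -/
def blockTR {R : Type*} [CommRing R] {N : ℕ}
    (M : Matrix (Conf (N + 1)) (Conf (N + 1)) R) : Matrix (Conf N) (Conf N) R :=
  Matrix.of fun x y => M (Fin.cons 0 x) (Fin.cons 1 y)

/-- Bottom-left block `G`. -/
def blockBL {R : Type*} [CommRing R] {N : ℕ}
    (M : Matrix (Conf (N + 1)) (Conf (N + 1)) R) : Matrix (Conf N) (Conf N) R :=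
  Matrix.of fun x y => M (Fin.cons 1 x) (Fin.cons 0 y)

/-- Bottom-right block `H`. -/
def blockBR {R : Type*} [CommRing R] {N : ℕ}
    (M : Matrix (Conf (N + 1)) (Conf (N + 1)) R) : Matrix (Conf N) (Conf N) R :=
  Matrix.of fun x y => M (Fin.cons 1 x) (Fin.cons 1 y)


theorem Qg_entry (Ql : Matrix (Fin 2 × Fin 2) (Fin 2 × Fin 2) ℂ)
    (hvan : ∀ i j k l : Fin 2, j ≠ l → Ql (k, l) (i, j) = 0) (N : ℕ)
    (a b j : Fin 2) (x : Conf (N + 1)) (y : Conf N) :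
    Qg Ql (N + 2) (Fin.cons a x) (Fin.cons b (Fin.cons j y)) =
      Ql (a, j) (b, j) * Qg Ql (N + 1) x (Fin.cons j y) := by
  have h1 : ∀ (n : ℕ) (c : Fin 2) (z : Conf n),
      (confEquiv n).symm (Fin.cons c z) = (c, z) := by
    intro n c z
    rw [Equiv.symm_apply_eq]; rfl
  have h2 : ∀ (c d : Fin 2) (z : Conf N),
      (confEquiv2 N).symm (Fin.cons c (Fin.cons d z)) = ((c, d), z) := by
    intro c d z
    rw [Equiv.symm_apply_eq]; rfl
  have h3 : ∀ (c d : Fin 2) (z : Conf N),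
      confEquiv2 N ((c, d), z) = Fin.cons c (Fin.cons d z) := fun _ _ _ => rfl
  rw [Qg, Matrix.mul_apply, ← (confEquiv2 N).sum_comp, Fintype.sum_prod_type,
    Fintype.sum_prod_type]
  simp only [Matrix.reindex_apply, Matrix.submatrix_apply, h3, h2, h1,
    Matrix.kroneckerMap_apply, Matrix.one_apply]
  rw [Finset.sum_eq_single a, Finset.sum_eq_single j, Finset.sum_eq_single y]
  · simp [mul_comm]
  · intro z _ hz; simp [hz]
  · simp
  · intro l _ hl; simp [hvan b j a l hl.symm]
  · simp
  · intro k _ hk; simp [hk.symm]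
  · simp

theorem trace_aux (Ql : Matrix (Fin 2 × Fin 2) (Fin 2 × Fin 2) ℂ)
    (hvan : ∀ i j k l : Fin 2, j ≠ l → Ql (k, l) (i, j) = 0) (N : ℕ) (a : Fin 2) :
    ∑ x : Conf (N + 1), Qg Ql (N + 2) (Fin.cons a x) (Fin.cons a x) =
      Ql (a, 0) (a, 0) * (∑ y : Conf N, Qg Ql (N + 1) (Fin.cons 0 y) (Fin.cons 0 y)) +
      Ql (a, 1) (a, 1) * (∑ y : Conf N, Qg Ql (N + 1) (Fin.cons 1 y) (Fin.cons 1 y)) := by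
  have h3 : ∀ (c : Fin 2) (z : Conf N), confEquiv N (c, z) = Fin.cons c z := fun _ _ => rfl
  rw [← (confEquiv N).sum_comp, Fintype.sum_prod_type, Fin.sum_univ_two]
  simp only [h3, Qg_entry Ql hvan, Finset.mul_sum]

/-- trace recursions for the diagonal blocks, for `N ≥ 2`:
`tr E_N = a₀₀⁰⁰ tr E_{N-1} + a₀₁⁰¹ tr H_{N-1}` and
`tr H_N = a₁₀¹⁰ tr E_{N-1} + a₁₁¹¹ tr H_{N-1}`. -/
theorem stmt3 (Ql : Matrix (Fin 2 × Fin 2) (Fin 2 × Fin 2) ℂ) (hvan : ∀ i j k l : Fin 2, j ≠ l → Ql (k, l) (i, j) = 0) (N : ℕ) :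
    Matrix.trace (blockTL (Qg Ql (N + 2))) =
        Ql (0, 0) (0, 0) * Matrix.trace (blockTL (Qg Ql (N + 1))) +
        Ql (0, 1) (0, 1) * Matrix.trace (blockBR (Qg Ql (N + 1))) ∧
    Matrix.trace (blockBR (Qg Ql (N + 2))) =
        Ql (1, 0) (1, 0) * Matrix.trace (blockTL (Qg Ql (N + 1))) +
        Ql (1, 1) (1, 1) * Matrix.trace (blockBR (Qg Ql (N + 1))) := by
  exact ⟨trace_aux Ql hvan N 0, trace_aux Ql hvan N 1⟩
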